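/- arXiv:1409.8234 — 2 statements merged into one kernel-verified Lean document; each statement's English description precedes it below -/
import Mathlib

section
/- Let d ≥ 2, let g₀, g₁, ..., g_d : ℤ → ℝ take values in [-1,1] and be supported on [-N, N], and let a₂, ..., a_d ∈ ℤ² be such that the vectors (1,0), (0,1), a₂, ..., a_d are pairwise linearly independent over ℚ. Then |∑_{z∈ℤ²} g₀(z₀)·g₁(z₁)·g₂(a₂·z)···g_d(a_d·z)| ≤ C_d · N^{2 - (d+1)/2^d} · ‖g_d‖_{U^d} for a constant C_d depending only on d. -/
open Finset

/-- The multiplicative difference operator `Δ_h f (x) = f (x + h) * f x`. -/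
noncomputable def deltaOp (h : ℤ) (f : ℤ → ℝ) : ℤ → ℝ := fun x => f (x + h) * f x

/-- `gowersSum d f = ‖f‖_{U^d}^{2^d} = ∑_{h₁,…,h_d} ∑_x Δ_{h₁} ⋯ Δ_{h_d} f (x)`. -/
noncomputable def gowersSum : ℕ → (ℤ → ℝ) → ℝ
  | 0, f => ∑ᶠ x : ℤ, f x
  | d + 1, f => ∑ᶠ h : ℤ, gowersSum d (deltaOp h f)

/-- The sum over the shifts by multiples of `v` of the correlations of `F` is a sum of squares,
one for each coset of `ℤ v`, the cosets being the fibres of `q`. -/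
theorem finsum_correlation_eq {G ι : Type*} [AddCommGroup G] [DecidableEq ι]
    (v : G) (hv : Function.Injective fun k : ℤ => k • v) (q : G → ι)
    (hq : ∀ z w, q w = q z ↔ ∃ k : ℤ, z + k • v = w)
    (F : G → ℝ) (Z : Finset G) (hZ : Function.support F ⊆ Z) :
    ∑ᶠ k : ℤ, ∑ᶠ z, F (z + k • v) * F z =
      ∑ n ∈ Z.image q, (∑ z ∈ Z with q z = n, F z) ^ 2 := by
  have hinj : ∀ z, Function.Injective fun k : ℤ => z + k • v := fun z k l h =>
    hv (add_left_cancel h)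
  have hfin : ∀ z, (Function.support fun k : ℤ => F (z + k • v) * F z).Finite := fun z =>
    ((Z.finite_toSet.subset hZ).preimage (hinj z).injOn).subset
      fun k hk => left_ne_zero_of_mul hk
  have horbit : ∀ z, ∑ᶠ k : ℤ, F (z + k • v) = ∑ w ∈ Z with q w = q z, F w := by
    intro z
    rw [← finsum_mem_range (hinj z)]
    apply finsum_mem_eq_sum_of_inter_support_eq
    ext w
    have := @hZ w
    simp only [Set.mem_inter_iff, Set.mem_range, coe_filter, Set.mem_ofPred_eq, hq]
    tauto
  calc ∑ᶠ k : ℤ, ∑ᶠ z, F (z + k • v) * F z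
      = ∑ᶠ k : ℤ, ∑ z ∈ Z, F (z + k • v) * F z :=
        finsum_congr fun k => finsum_eq_sum_of_support_subset _
          fun z hz => hZ (right_ne_zero_of_mul hz)
    _ = ∑ z ∈ Z, (∑ w ∈ Z with q w = q z, F w) * F z := by
        rw [finsum_sum_comm _ _ fun z _ => hfin z]
        refine sum_congr rfl fun z _ => ?_
        rw [← finsum_mul, horbit]
    _ = _ := by
        rw [← sum_fiberwise_of_maps_to (g := q) (t := Z.image q)
          fun z hz => mem_image_of_mem q hz]
        refine sum_congr rfl fun n _ => ?_
        rw [sq, mul_sum]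
        refine sum_congr rfl fun z hz => ?_
        rw [(mem_filter.1 hz).2]

/-- The sum of `Δ_{c₁ k₁} ⋯ Δ_{c_m k_m} f (x)` over all `x` and all integers `k₁, …, k_m`. -/
noncomputable def boxSum : List ℤ → (ℤ → ℝ) → ℝ
  | [], f => ∑ᶠ x : ℤ, f x
  | c :: cs, f => ∑ᶠ k : ℤ, boxSum cs (deltaOp (k * c) f)

theorem gowersSum_eq_boxSum (d : ℕ) (f : ℤ → ℝ) :
    gowersSum d f = boxSum (List.replicate d 1) f := by
  induction d generalizing f with
  | zero => rfl
  | succ d ih => simp [gowersSum, List.replicate_succ, boxSum, ih]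

theorem deltaOp_comm (h k : ℤ) (f : ℤ → ℝ) :
    deltaOp h (deltaOp k f) = deltaOp k (deltaOp h f) := by
  ext x
  simp only [deltaOp]
  rw [add_right_comm]
  ring

theorem deltaOp_zero (h : ℤ) : deltaOp h 0 = 0 := by
  ext x
  simp [deltaOp]

theorem finite_support_deltaOp {f : ℤ → ℝ} (hf : (Function.support f).Finite) (h : ℤ) :
    (Function.support (deltaOp h f)).Finite :=
  hf.subset fun _ hx => right_ne_zero_of_mul hx

theorem boxSum_zero (cs : List ℤ) : boxSum cs 0 = 0 := by
  induction cs with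
  | nil => simp [boxSum]
  | cons c cs ih => simp [boxSum, deltaOp_zero, ih]

theorem finite_setOf_deltaOp_ne_zero {f : ℤ → ℝ} (hf : (Function.support f).Finite) :
    {h : ℤ | deltaOp h f ≠ 0}.Finite := by
  refine (hf.image2 (fun x y => x - y) hf).subset fun h hh => ?_
  obtain ⟨x, hx⟩ := Function.ne_iff.1 hh
  exact ⟨x + h, left_ne_zero_of_mul hx, x, right_ne_zero_of_mul hx, by ring⟩

theorem finite_support_boxSum_deltaOp {f : ℤ → ℝ} (hf : (Function.support f).Finite)
    (cs : List ℤ) : (Function.support fun h => boxSum cs (deltaOp h f)).Finite := by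
  refine (finite_setOf_deltaOp_ne_zero hf).subset fun h hh h0 => hh ?_
  simp only [h0, boxSum_zero]

theorem mul_right_injective_int {c : ℤ} (hc : c ≠ 0) : Function.Injective fun k : ℤ => k * c :=
  fun _ _ h => mul_right_cancel₀ hc h

theorem finite_support_boxSum_deltaOp_mul {f : ℤ → ℝ} (hf : (Function.support f).Finite)
    (cs : List ℤ) {c : ℤ} (hc : c ≠ 0) :
    (Function.support fun k : ℤ => boxSum cs (deltaOp (k * c) f)).Finite :=
  (finite_support_boxSum_deltaOp hf cs).preimage (mul_right_injective_int hc).injOn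

theorem emod_eq_emod_iff_exists (c z w : ℤ) : w % c = z % c ↔ ∃ k : ℤ, z + k • c = w := by
  rw [Int.emod_eq_emod_iff_emod_sub_eq_zero, ← Int.dvd_iff_emod_eq_zero]
  constructor
  · rintro ⟨k, hk⟩
    exact ⟨k, by simp only [smul_eq_mul]; linarith⟩
  · rintro ⟨k, rfl⟩
    exact ⟨k, by simp only [smul_eq_mul]; ring⟩

theorem boxSum_singleton {c : ℤ} (hc : c ≠ 0) (f : ℤ → ℝ) (Z : Finset ℤ)
    (hZ : Function.support f ⊆ Z) :
    boxSum [c] f = ∑ n ∈ Z.image (· % c), (∑ z ∈ Z with z % c = n, f z) ^ 2 :=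
  finsum_correlation_eq c (mul_right_injective_int hc) (· % c) (emod_eq_emod_iff_exists c) f Z hZ

theorem boxSum_nonneg {cs : List ℤ} (hne : cs ≠ []) (hcs : ∀ c ∈ cs, c ≠ 0) {f : ℤ → ℝ}
    (hf : (Function.support f).Finite) : 0 ≤ boxSum cs f := by
  induction cs generalizing f with
  | nil => exact absurd rfl hne
  | cons c cs ih =>
    cases cs with
    | nil =>
      rw [boxSum_singleton (hcs c (by simp)) f hf.toFinset (by simp)]
      positivity
    | cons c' cs =>
      exact finsum_nonneg fun k => ih (by simp) (fun x hx => hcs x (List.mem_cons_of_mem _ hx))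
        (finite_support_deltaOp hf _)

theorem sum_boxSum_deltaOp_le {cs : List ℤ} (hne : cs ≠ []) (hcs : ∀ c ∈ cs, c ≠ 0) {c : ℤ}
    (hc : c ≠ 0) {f : ℤ → ℝ} (hf : (Function.support f).Finite) (s : Finset ℤ) :
    ∑ k ∈ s, boxSum cs (deltaOp (k * c) f) ≤ boxSum (c :: cs) f := by
  have hfin := finite_support_boxSum_deltaOp_mul hf cs hc
  rw [boxSum, finsum_eq_sum_of_support_subset (s := s ∪ hfin.toFinset) _ (by simp)]
  exact sum_le_sum_of_subset_of_nonneg subset_union_left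
    fun k _ _ => boxSum_nonneg hne hcs (finite_support_deltaOp hf _)

theorem boxSum_cons_le_boxSum_one_cons {cs : List ℤ} (hne : cs ≠ []) (hcs : ∀ c ∈ cs, c ≠ 0)
    {c : ℤ} (hc : c ≠ 0) {f : ℤ → ℝ} (hf : (Function.support f).Finite) :
    boxSum (c :: cs) f ≤ boxSum (1 :: cs) f := by
  have hfin := finite_support_boxSum_deltaOp_mul hf cs hc
  rw [boxSum, finsum_eq_sum_of_support_subset (s := hfin.toFinset) _ (by simp)]
  refine le_of_eq_of_le ?_ (sum_boxSum_deltaOp_le hne hcs one_ne_zero hf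
    (hfin.toFinset.map ⟨_, mul_right_injective_int hc⟩))
  simp

theorem boxSum_pair_swap {a b : ℤ} (ha : a ≠ 0) (hb : b ≠ 0) {f : ℤ → ℝ}
    (hf : (Function.support f).Finite) : boxSum [a, b] f = boxSum [b, a] f := by
  have key : ∀ {c : ℤ}, c ≠ 0 → {k : ℤ | deltaOp (k * c) f ≠ 0}.Finite := fun hc =>
    (finite_setOf_deltaOp_ne_zero hf).preimage (mul_right_injective_int hc).injOn
  have hexp : ∀ {a b : ℤ} (ha : a ≠ 0) (hb : b ≠ 0), boxSum [a, b] f =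
      ∑ k ∈ (key ha).toFinset, ∑ l ∈ (key hb).toFinset,
        boxSum [] (deltaOp (l * b) (deltaOp (k * a) f)) := by
    intro a b ha hb
    rw [boxSum, finsum_eq_sum_of_support_subset]
    · refine sum_congr rfl fun k _ => ?_
      rw [boxSum, finsum_eq_sum_of_support_subset]
      intro l hl
      simp only [Set.Finite.coe_toFinset]
      intro h0
      refine hl ?_
      simp only [deltaOp_comm (l * b), h0, deltaOp_zero, boxSum_zero]
    · intro k hk
      simp only [Set.Finite.coe_toFinset]
      intro h0
      refine hk ?_
      simp only [h0, boxSum_zero]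
  rw [hexp ha hb, hexp hb ha, sum_comm]
  simp_rw [deltaOp_comm (_ * a)]

theorem boxSum_le_gowersSum {cs : List ℤ} (hlen : 2 ≤ cs.length) (hcs : ∀ c ∈ cs, c ≠ 0)
    {f : ℤ → ℝ} (hf : (Function.support f).Finite) : boxSum cs f ≤ gowersSum cs.length f := by
  induction cs generalizing f with
  | nil => simp at hlen
  | cons c cs ih =>
    have hc : c ≠ 0 := hcs c (by simp)
    have hcs' : ∀ x ∈ cs, x ≠ 0 := fun x hx => hcs x (List.mem_cons_of_mem _ hx)
    have hne : cs ≠ [] := by rintro rfl; simp at hlen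
    refine (boxSum_cons_le_boxSum_one_cons hne hcs' hc hf).trans ?_
    rcases lt_or_ge cs.length 2 with h | h
    · obtain ⟨b, rfl⟩ : ∃ b, cs = [b] := by
        rw [← List.length_eq_one_iff]
        have := List.length_pos_iff.2 hne
        omega
      rw [boxSum_pair_swap one_ne_zero (hcs' b (by simp)) hf, gowersSum_eq_boxSum]
      exact boxSum_cons_le_boxSum_one_cons (by simp) (by simp) (hcs' b (by simp)) hf
    · have h1 := finite_support_boxSum_deltaOp_mul hf cs one_ne_zero
      have h2 := finite_support_boxSum_deltaOp hf (List.replicate cs.length 1)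
      simp only [mul_one] at h1
      simp only [← gowersSum_eq_boxSum] at h2
      simp only [boxSum, gowersSum, List.length_cons, mul_one]
      exact finsum_le_finsum' h1 h2 (fun k => ih h hcs' (finite_support_deltaOp hf k))

/-- The integer dot product `a ⬝ z`. -/
def dotInt (a z : ℤ × ℤ) : ℤ := a.1 * z.1 + a.2 * z.2

theorem dotInt_add_zsmul (a z v : ℤ × ℤ) (k : ℤ) :
    dotInt a (z + k • v) = dotInt a z + k * dotInt a v := by
  simp only [dotInt, Prod.fst_add, Prod.snd_add, Prod.smul_fst, Prod.smul_snd, smul_eq_mul]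
  ring

/-- The kernel of a nonzero integer linear form in two variables is infinite cyclic. -/
theorem exists_dotInt_kernel_generator {a : ℤ × ℤ} (ha : a ≠ 0) :
    ∃ v : ℤ × ℤ, (Function.Injective fun k : ℤ => k • v) ∧
      (∀ z w, dotInt a w = dotInt a z ↔ ∃ k : ℤ, z + k • v = w) ∧
      ∀ b : ℤ × ℤ, a.1 * b.2 ≠ a.2 * b.1 → dotInt b v ≠ 0 := by
  obtain ⟨p, q⟩ := a
  have hpos : 0 < Int.gcd p q := by
    rw [Nat.pos_iff_ne_zero, Ne, Int.gcd_eq_zero_iff]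
    rintro ⟨rfl, rfl⟩
    exact ha rfl
  obtain ⟨g, p', q', hg, hcop, rfl, rfl⟩ := Int.exists_gcd_one' hpos
  have hg' : (g : ℤ) ≠ 0 := by exact_mod_cast hg.ne'
  obtain ⟨s, t, hst⟩ := Int.isCoprime_iff_gcd_eq_one.2 hcop
  refine ⟨(q', -p'), fun k l h => ?_, fun z w => ⟨fun h => ?_, ?_⟩, fun b hb h => hb ?_⟩
  · simp only [Prod.smul_mk, smul_eq_mul, Prod.mk.injEq] at h
    linear_combination (l - k) * hst + t * h.1 - s * h.2
  · obtain ⟨z₀, z₁⟩ := z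
    obtain ⟨w₀, w₁⟩ := w
    have h' : p' * (w₀ - z₀) + q' * (w₁ - z₁) = 0 := by
      apply mul_left_cancel₀ hg'
      simp only [dotInt] at h
      linear_combination h
    refine ⟨t * (w₀ - z₀) - s * (w₁ - z₁), ?_⟩
    simp only [Prod.smul_mk, smul_eq_mul, Prod.mk_add_mk, Prod.mk.injEq]
    constructor
    · linear_combination (w₀ - z₀) * hst - s * h'
    · linear_combination (w₁ - z₁) * hst - t * h'
  · rintro ⟨k, rfl⟩
    rw [dotInt_add_zsmul]
    simp only [dotInt]
    ring
  · simp only [dotInt] at h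
    linear_combination -(g : ℤ) * h

theorem sum_sq_le_of_bounded {N : ℕ} {g : ℤ → ℝ} (hb : ∀ x, |g x| ≤ 1)
    (hs : ∀ x : ℤ, x ∉ Set.Icc (-(N : ℤ)) N → g x = 0) (s : Finset ℤ) :
    ∑ n ∈ s, g n ^ 2 ≤ 2 * N + 1 := by
  calc ∑ n ∈ s, g n ^ 2 ≤ ∑ n ∈ Icc (-(N : ℤ)) N, g n ^ 2 := by
        rw [← sum_subset (inter_subset_left (s₁ := s) (s₂ := Icc (-(N : ℤ)) N)) fun n hn hn' => by
          rw [hs n fun h => hn' (mem_inter.2 ⟨hn, mem_Icc.2 h⟩), zero_pow two_ne_zero]]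
        exact sum_le_sum_of_subset_of_nonneg inter_subset_right fun _ _ _ => sq_nonneg _
    _ ≤ ∑ n ∈ Icc (-(N : ℤ)) N, 1 := sum_le_sum fun n _ => (sq_le_one_iff_abs_le_one _).2 (hb n)
    _ = 2 * N + 1 := by
        have : ((N : ℤ) + 1 - -N).toNat = 2 * N + 1 := by omega
        simp only [sum_const, Int.card_Icc, this]
        simp

theorem finite_setOf_dotInt_mem {a b : ℤ × ℤ} (hab : a.1 * b.2 ≠ a.2 * b.1) {s t : Set ℤ}
    (hs : s.Finite) (ht : t.Finite) : {z | dotInt a z ∈ s ∧ dotInt b z ∈ t}.Finite := by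
  refine ((hs.prod ht).preimage (f := fun z => (dotInt a z, dotInt b z)) ?_).subset
    fun z hz => hz
  rintro ⟨z₀, z₁⟩ - ⟨w₀, w₁⟩ - h
  simp only [dotInt, Prod.mk.injEq] at h
  have hD : a.1 * b.2 - a.2 * b.1 ≠ 0 := sub_ne_zero.2 hab
  refine Prod.ext (mul_left_cancel₀ hD ?_) (mul_left_cancel₀ hD ?_)
  · linear_combination b.2 * h.1 - a.2 * h.2
  · linear_combination a.1 * h.2 - b.1 * h.1

theorem sq_sum_mul_le_sum_fiber_sq {G : Type*} {N : ℕ} {g : ℤ → ℝ} (hb : ∀ x, |g x| ≤ 1)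
    (hs : ∀ x : ℤ, x ∉ Set.Icc (-(N : ℤ)) N → g x = 0) (q : G → ℤ) (F : G → ℝ) (Z : Finset G) :
    (∑ z ∈ Z, g (q z) * F z) ^ 2 ≤
      (2 * N + 1) * ∑ n ∈ Z.image q, (∑ z ∈ Z with q z = n, F z) ^ 2 := by
  have h : ∑ z ∈ Z, g (q z) * F z = ∑ n ∈ Z.image q, g n * ∑ z ∈ Z with q z = n, F z := by
    rw [← sum_fiberwise_of_maps_to (g := q) (t := Z.image q) fun z hz => mem_image_of_mem q hz]
    refine sum_congr rfl fun n _ => ?_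
    rw [mul_sum]
    exact sum_congr rfl fun z hz => by rw [(mem_filter.1 hz).2]
  rw [h]
  refine (sum_mul_sq_le_sq_mul_sq _ _ _).trans ?_
  gcongr
  exact sum_sq_le_of_bounded hb hs _

theorem sq_finsum_mul_le_correlation {G : Type*} [AddCommGroup G] {N : ℕ} {g : ℤ → ℝ}
    (hb : ∀ x, |g x| ≤ 1) (hs : ∀ x : ℤ, x ∉ Set.Icc (-(N : ℤ)) N → g x = 0)
    {v : G} (hv : Function.Injective fun k : ℤ => k • v) {q : G → ℤ}
    (hq : ∀ z w, q w = q z ↔ ∃ k : ℤ, z + k • v = w)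
    {F : G → ℝ} (hF : (Function.support F).Finite) :
    (∑ᶠ z, g (q z) * F z) ^ 2 ≤ (2 * N + 1) * ∑ᶠ k : ℤ, ∑ᶠ z, F (z + k • v) * F z := by
  rw [finsum_correlation_eq v hv q hq F hF.toFinset (by simp),
    finsum_eq_sum_of_support_subset (s := hF.toFinset)]
  · exact sq_sum_mul_le_sum_fiber_sq hb hs q F _
  · intro z hz
    simpa using right_ne_zero_of_mul hz

theorem sq_finsum_mul_le_boxSum_singleton {N : ℕ} {g₀ g₁ : ℤ → ℝ} (hb : ∀ x, |g₀ x| ≤ 1)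
    (hs₀ : ∀ x : ℤ, x ∉ Set.Icc (-(N : ℤ)) N → g₀ x = 0)
    (hs₁ : ∀ x : ℤ, x ∉ Set.Icc (-(N : ℤ)) N → g₁ x = 0)
    {a b v : ℤ × ℤ} (hab : a.1 * b.2 ≠ a.2 * b.1)
    (hv : ∀ z w, dotInt a w = dotInt a z ↔ ∃ k : ℤ, z + k • v = w) (hc : dotInt b v ≠ 0) :
    (∑ᶠ z, g₀ (dotInt a z) * g₁ (dotInt b z)) ^ 2 ≤
      (2 * N + 1) ^ 2 * boxSum [dotInt b v] g₁ := by
  have hmem : ∀ {g : ℤ → ℝ}, (∀ x : ℤ, x ∉ Set.Icc (-(N : ℤ)) N → g x = 0) →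
      ∀ {x}, g x ≠ 0 → x ∈ Set.Icc (-(N : ℤ)) N := fun hs x hx => by
    by_contra h
    exact hx (hs x h)
  have hfin := finite_setOf_dotInt_mem hab (Set.finite_Icc (-(N : ℤ)) N)
    (Set.finite_Icc (-(N : ℤ)) N)
  set Z := hfin.toFinset with hZ
  have hZmem : ∀ z, z ∈ Z ↔ dotInt a z ∈ Set.Icc (-(N : ℤ)) N ∧
      dotInt b z ∈ Set.Icc (-(N : ℤ)) N := fun z => by simp [hZ]
  rw [finsum_eq_sum_of_support_subset (s := Z) _ fun z hz => (hZmem z).2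
    ⟨hmem hs₀ (left_ne_zero_of_mul hz), hmem hs₁ (right_ne_zero_of_mul hz)⟩]
  refine (sq_sum_mul_le_sum_fiber_sq hb hs₀ _ _ _).trans ?_
  rw [sq, mul_assoc]
  gcongr
  have hfiber : ∀ n ∈ Z.image (dotInt a),
      (∑ z ∈ Z with dotInt a z = n, g₁ (dotInt b z)) ^ 2 ≤ boxSum [dotInt b v] g₁ := by
    intro n hn
    obtain ⟨z₀, hz₀, rfl⟩ := mem_image.1 hn
    rw [boxSum_singleton hc g₁ (Icc (-(N : ℤ)) N) fun x hx => by simpa using hmem hs₁ hx]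
    have hsum : ∑ z ∈ Z with dotInt a z = dotInt a z₀, g₁ (dotInt b z) =
        ∑ x ∈ Icc (-(N : ℤ)) N with x % dotInt b v = dotInt b z₀ % dotInt b v, g₁ x := by
      refine sum_nbij (dotInt b) ?_ ?_ ?_ fun _ _ => rfl
      · intro z hz
        obtain ⟨hz, hz'⟩ := mem_filter.1 hz
        obtain ⟨k, rfl⟩ := (hv _ _).1 hz'
        exact mem_filter.2 ⟨by simpa using ((hZmem _).1 hz).2,
          (emod_eq_emod_iff_exists _ _ _).2 ⟨k, (dotInt_add_zsmul _ _ _ _).symm⟩⟩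
      · intro z hz w hw h
        obtain ⟨k, rfl⟩ := (hv _ _).1 (mem_filter.1 hz).2
        obtain ⟨l, rfl⟩ := (hv _ _).1 (mem_filter.1 hw).2
        simp only [dotInt_add_zsmul, add_right_inj] at h
        rw [mul_right_cancel₀ hc h]
      · intro x hx
        obtain ⟨hx, hx'⟩ := mem_filter.1 hx
        obtain ⟨k, rfl⟩ := (emod_eq_emod_iff_exists _ _ _).1 hx'
        have hk : dotInt a (z₀ + k • v) = dotInt a z₀ := (hv _ _).2 ⟨k, rfl⟩
        have hk' : dotInt b (z₀ + k • v) = dotInt b z₀ + k • dotInt b v :=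
          dotInt_add_zsmul _ _ _ _
        refine ⟨z₀ + k • v, mem_coe.2 (mem_filter.2 ⟨(hZmem _).2 ⟨?_, ?_⟩, hk⟩), hk'⟩
        · rw [hk]
          exact ((hZmem _).1 hz₀).1
        · rw [hk']
          simpa using hx
    rw [hsum]
    exact single_le_sum (f := fun n => (∑ x ∈ Icc (-(N : ℤ)) N with x % dotInt b v = n, g₁ x) ^ 2)
      (fun _ _ => sq_nonneg _)
      (mem_image_of_mem _ (by simpa using ((hZmem _).1 hz₀).2))
  refine (sum_le_card_nsmul _ _ _ hfiber).trans ?_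
  rw [nsmul_eq_mul]
  have hQ : 0 ≤ boxSum [dotInt b v] g₁ := boxSum_nonneg (by simp) (by simpa using hc)
    ((Set.finite_Icc (-(N : ℤ)) N).subset fun x hx => hmem hs₁ hx)
  gcongr
  have hcard : #(Z.image (dotInt a)) ≤ #(Icc (-(N : ℤ)) N) := card_le_card fun n hn => by
    obtain ⟨z, hz, rfl⟩ := mem_image.1 hn
    simpa using ((hZmem _).1 hz).1
  rw [Int.card_Icc] at hcard
  have : #(Z.image (dotInt a)) ≤ 2 * N + 1 := by omega
  exact_mod_cast this

theorem abs_deltaOp_le_one {f : ℤ → ℝ} (hf : ∀ x, |f x| ≤ 1) (h x : ℤ) : |deltaOp h f x| ≤ 1 := by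
  rw [deltaOp, abs_mul]
  exact mul_le_one₀ (hf _) (abs_nonneg _) (hf _)

theorem deltaOp_eq_zero_of_notMem {N : ℕ} {f : ℤ → ℝ}
    (hf : ∀ x : ℤ, x ∉ Set.Icc (-(N : ℤ)) N → f x = 0) (h x : ℤ)
    (hx : x ∉ Set.Icc (-(N : ℤ)) N) : deltaOp h f x = 0 := by
  rw [deltaOp, hf x hx, mul_zero]

theorem deltaOp_mul_eq_zero {N : ℕ} {f : ℤ → ℝ}
    (hf : ∀ x : ℤ, x ∉ Set.Icc (-(N : ℤ)) N → f x = 0) {c k : ℤ} (hc : c ≠ 0)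
    (hk : k ∉ Icc (-(2 * N : ℤ)) (2 * N)) : deltaOp (k * c) f = 0 := by
  ext x
  by_contra h
  have h1 : x + k * c ∈ Set.Icc (-(N : ℤ)) N := by
    by_contra h'
    exact h (by simp [deltaOp, hf _ h'])
  have h2 : x ∈ Set.Icc (-(N : ℤ)) N := by
    by_contra h'
    exact h (by simp [deltaOp, hf _ h'])
  rw [Set.mem_Icc] at h1 h2
  have h3 : |k * c| ≤ 2 * N := abs_le.2 ⟨by linarith, by linarith⟩
  have h4 : |k| ≤ |k * c| := by
    rw [abs_mul]
    exact le_mul_of_one_le_right (abs_nonneg _) (Int.one_le_abs hc)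
  exact hk (mem_Icc.2 (abs_le.1 (h4.trans h3)))

/-- The sum over `z ∈ ℤ²` of `∏ᵢ gᵢ (aᵢ ⬝ z)`. -/
noncomputable def formSum {n : ℕ} (g : Fin n → ℤ → ℝ) (a : Fin n → ℤ × ℤ) : ℝ :=
  ∑ᶠ z : ℤ × ℤ, ∏ i, g i (dotInt (a i) z)

theorem finite_support_prod_dotInt {m : ℕ} {g : Fin (m + 2) → ℤ → ℝ} {a : Fin (m + 2) → ℤ × ℤ}
    (hg : ∀ i, (Function.support (g i)).Finite)
    (ha : ∀ i j, i ≠ j → (a i).1 * (a j).2 ≠ (a i).2 * (a j).1) :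
    (Function.support fun z => ∏ i, g i (dotInt (a i) z)).Finite := by
  refine (finite_setOf_dotInt_mem (ha 0 1 (by simp)) (hg 0) (hg 1)).subset fun z hz => ?_
  rw [Function.mem_support, prod_ne_zero_iff] at hz
  exact ⟨hz 0 (mem_univ _), hz 1 (mem_univ _)⟩

/-- Cauchy–Schwarz eliminates the first form: the remaining functions are differenced along the
kernel of `a 0`. -/
theorem sq_formSum_le {m N : ℕ} {g : Fin (m + 3) → ℤ → ℝ} {a : Fin (m + 3) → ℤ × ℤ}
    (hb : ∀ i x, |g i x| ≤ 1)
    (hs : ∀ i, ∀ x : ℤ, x ∉ Set.Icc (-(N : ℤ)) N → g i x = 0)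
    (ha : ∀ i j, i ≠ j → (a i).1 * (a j).2 ≠ (a i).2 * (a j).1) {v : ℤ × ℤ}
    (hinj : Function.Injective fun k : ℤ => k • v)
    (hv : ∀ z w, dotInt (a 0) w = dotInt (a 0) z ↔ ∃ k : ℤ, z + k • v = w)
    (hc : ∀ i : Fin (m + 2), dotInt (a i.succ) v ≠ 0) :
    formSum g a ^ 2 ≤ (2 * N + 1) * ∑ k ∈ Icc (-(2 * N : ℤ)) (2 * N),
      formSum (fun i => deltaOp (k * dotInt (a i.succ) v) (g i.succ)) fun i => a i.succ := by
  have hsupp : ∀ i : Fin (m + 2), (Function.support (g i.succ)).Finite := fun i =>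
    (Set.finite_Icc (-(N : ℤ)) N).subset fun x hx => by
      by_contra h
      exact hx (hs _ x h)
  have hF := finite_support_prod_dotInt hsupp (a := fun i => a i.succ)
    fun i j hij => ha _ _ fun h => hij (Fin.succ_injective _ h)
  have key := sq_finsum_mul_le_correlation (hb 0) (hs 0) hinj hv hF
  simp only [formSum, Fin.prod_univ_succ (n := m + 2)]
  refine key.trans_eq ?_
  congr 1
  rw [finsum_eq_sum_of_support_subset (s := Icc (-(2 * N : ℤ)) (2 * N))]
  · refine sum_congr rfl fun k _ => finsum_congr fun z => ?_
    simp only [← prod_mul_distrib, deltaOp, dotInt_add_zsmul]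
  · intro k hk
    by_contra h
    refine hk ?_
    refine finsum_eq_zero_of_forall_eq_zero fun z => ?_
    rw [← prod_mul_distrib]
    refine prod_eq_zero (mem_univ 0) ?_
    rw [dotInt_add_zsmul]
    exact congrFun (deltaOp_mul_eq_zero (hs _) (hc 0) h) _

theorem exists_formSum_pow_le_boxSum (m : ℕ) :
    ∃ (C : ℝ) (e : ℕ), 0 < C ∧ e + (m + 2) = 2 ^ (m + 2) ∧
      ∀ a : Fin (m + 2) → ℤ × ℤ, (∀ i j, i ≠ j → (a i).1 * (a j).2 ≠ (a i).2 * (a j).1) →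
        ∃ cs : List ℤ, cs.length = m + 1 ∧ (∀ c ∈ cs, c ≠ 0) ∧
          ∀ (N : ℕ) (g : Fin (m + 2) → ℤ → ℝ), 1 ≤ N → (∀ i x, |g i x| ≤ 1) →
            (∀ i, ∀ x : ℤ, x ∉ Set.Icc (-(N : ℤ)) N → g i x = 0) →
            formSum g a ^ 2 ^ (m + 1) ≤ C * (N : ℝ) ^ e * boxSum cs (g (Fin.last (m + 1))) := by
  have hne : ∀ {n : ℕ} {a : Fin (n + 2) → ℤ × ℤ},
      (∀ i j, i ≠ j → (a i).1 * (a j).2 ≠ (a i).2 * (a j).1) → a 0 ≠ 0 := fun ha h =>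
    ha 0 1 (by simp) (by simp [h])
  have hfin : ∀ {N : ℕ} {f : ℤ → ℝ}, (∀ x : ℤ, x ∉ Set.Icc (-(N : ℤ)) N → f x = 0) →
      (Function.support f).Finite := fun {N} {f} hf =>
    (Set.finite_Icc (-(N : ℤ)) N).subset fun x hx => by
      by_contra h
      exact hx (hf x h)
  induction m with
  | zero =>
    refine ⟨9, 2, by norm_num, by norm_num, fun a ha => ?_⟩
    obtain ⟨v, -, hv, hc⟩ := exists_dotInt_kernel_generator (hne ha)
    have hc1 := hc _ (ha 0 1 (by simp))
    refine ⟨[dotInt (a 1) v], rfl, by simpa using hc1, fun N g hN hb hs => ?_⟩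
    have key := sq_finsum_mul_le_boxSum_singleton (hb 0) (hs 0) (hs 1) (ha 0 1 (by simp)) hv hc1
    have hN' : (1 : ℝ) ≤ N := by exact_mod_cast hN
    have hQ : 0 ≤ boxSum [dotInt (a 1) v] (g 1) :=
      boxSum_nonneg (by simp) (by simpa using hc1) (hfin (hs 1))
    have hform : formSum g a = ∑ᶠ z, g 0 (dotInt (a 0) z) * g 1 (dotInt (a 1) z) :=
      finsum_congr fun z => Fin.prod_univ_two _
    rw [← hform] at key
    refine key.trans ?_
    change _ ≤ 9 * (N : ℝ) ^ 2 * boxSum [dotInt (a 1) v] (g 1)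
    gcongr
    nlinarith
  | succ m ih =>
    obtain ⟨C, e, hC, he, ih⟩ := ih
    obtain ⟨p, hp⟩ : ∃ p, 2 ^ (m + 1) = p + 1 :=
      ⟨2 ^ (m + 1) - 1, (Nat.sub_add_cancel Nat.one_le_two_pow).symm⟩
    refine ⟨3 ^ (p + 1) * 5 ^ p * C, p + 1 + p + e, by positivity, ?_, fun a ha => ?_⟩
    · have h2 : 2 ^ (m + 2) = 2 * (p + 1) := by rw [pow_succ, hp]; ring
      have h3 : 2 ^ (m + 1 + 2) = 4 * (p + 1) := by rw [pow_succ, pow_succ, hp]; ring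
      omega
    obtain ⟨v, hinj, hv, hc⟩ := exists_dotInt_kernel_generator (hne ha)
    have hc' : ∀ i : Fin (m + 2), dotInt (a i.succ) v ≠ 0 := fun i =>
      hc _ (ha 0 i.succ (Fin.succ_ne_zero i).symm)
    obtain ⟨cs, hlen, hcs, ih⟩ := ih (fun i => a i.succ)
      fun i j hij => ha _ _ fun h => hij (Fin.succ_injective _ h)
    refine ⟨dotInt (a (Fin.last (m + 1)).succ) v :: cs, by simp [hlen],
      List.forall_mem_cons.2 ⟨hc' _, hcs⟩, fun N g hN hb hs => ?_⟩
    have hN' : (1 : ℝ) ≤ N := by exact_mod_cast hN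
    have hcs_ne : cs ≠ [] := by rintro rfl; simp at hlen
    set K := Icc (-(2 * N : ℤ)) (2 * N) with hK
    set T : ℤ → ℝ := fun k =>
      formSum (fun i => deltaOp (k * dotInt (a i.succ) v) (g i.succ)) fun i => a i.succ with hT
    set Q := boxSum (dotInt (a (Fin.last (m + 1)).succ) v :: cs) (g (Fin.last (m + 2))) with hQ
    have hKcard : (#K : ℝ) ≤ 5 * N := by
      have : #K = 4 * N + 1 := by rw [hK, Int.card_Icc]; omega
      rw [this]
      push_cast
      linarith
    have hsq : formSum g a ^ 2 ≤ 3 * N * ∑ k ∈ K, |T k| := by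
      refine (sq_formSum_le hb hs ha hinj hv hc').trans ?_
      calc _ ≤ (2 * N + 1) * ∑ k ∈ K, |T k| := by
            gcongr
            exact le_abs_self _
        _ ≤ _ := by
            gcongr
            linarith
    have heven : Even (p + 1) := hp ▸ (Nat.even_pow.2 ⟨even_two, by simp⟩)
    have hTk : ∀ k, |T k| ^ (p + 1) ≤ C * (N : ℝ) ^ e *
        boxSum cs (deltaOp (k * dotInt (a (Fin.last (m + 1)).succ) v) (g (Fin.last (m + 2)))) := by
      intro k
      rw [heven.pow_abs, ← hp]
      exact ih N _ hN (fun i => abs_deltaOp_le_one (hb _) _)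
        fun i => deltaOp_eq_zero_of_notMem (hs _) _
    have hpow : formSum g a ^ 2 ^ (m + 1 + 1) = (formSum g a ^ 2) ^ (p + 1) := by
      rw [← pow_mul, pow_succ 2 (m + 1), hp, mul_comm]
    calc formSum g a ^ 2 ^ (m + 1 + 1) = (formSum g a ^ 2) ^ (p + 1) := hpow
      _ ≤ (3 * N * ∑ k ∈ K, |T k|) ^ (p + 1) := by gcongr
      _ = (3 * N) ^ (p + 1) * (∑ k ∈ K, |T k|) ^ (p + 1) := mul_pow _ _ _
      _ ≤ (3 * N) ^ (p + 1) * ((#K : ℝ) ^ p * ∑ k ∈ K, |T k| ^ (p + 1)) := by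
          gcongr
          exact pow_sum_le_card_mul_sum_pow (fun _ _ => abs_nonneg _) p
      _ ≤ (3 * N) ^ (p + 1) * ((5 * N) ^ p * (C * (N : ℝ) ^ e * Q)) := by
          gcongr
          refine (sum_le_sum fun k _ => hTk k).trans ?_
          rw [← mul_sum]
          gcongr
          exact sum_boxSum_deltaOp_le hcs_ne hcs (hc' _) (hfin (hs _)) K
      _ = 3 ^ (p + 1) * 5 ^ p * C * (N : ℝ) ^ (p + 1 + p + e) * Q := by ring

/-- Generalised von Neumann for unconstrained bilinear forms: if the vectors
`(1,0), (0,1), a₂, …, a_d ∈ ℤ²` are pairwise linearly independent and each `gᵢ`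
is `1`-bounded and supported on `[-N, N]`, then
`|∑_z g₀(z₀) g₁(z₁) g₂(a₂⬝z) ⋯ g_d(a_d⬝z)| ≤ C_d N^{2-(d+1)/2^d} ‖g_d‖_{U^d}`. -/
theorem unconstrained_von_neumann (d : ℕ) (hd : 2 ≤ d) :
    ∃ C : ℝ, 0 < C ∧
      ∀ (N : ℕ), 1 ≤ N → ∀ (g : Fin (d + 1) → ℤ → ℝ) (a : Fin (d + 1) → ℤ × ℤ),
        (∀ i x, |g i x| ≤ 1) →
        (∀ (i : Fin (d + 1)) (x : ℤ), x ∉ Set.Icc (-(N : ℤ)) N → g i x = 0) →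
        (∀ i : Fin (d + 1), 2 ≤ (i : ℕ) → (a i).1 ≠ 0 ∧ (a i).2 ≠ 0) →
        (∀ i j : Fin (d + 1), 2 ≤ (i : ℕ) → 2 ≤ (j : ℕ) → i ≠ j →
          (a i).1 * (a j).2 ≠ (a i).2 * (a j).1) →
        |∑ᶠ z₀ : ℤ, ∑ᶠ z₁ : ℤ, g 0 z₀ * g 1 z₁ *
            ∏ i ∈ Finset.univ.filter (fun i : Fin (d + 1) => 2 ≤ (i : ℕ)),
              g i ((a i).1 * z₀ + (a i).2 * z₁)| ≤
          C * (N : ℝ) ^ ((2 : ℝ) - (d + 1) / 2 ^ d) *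
            gowersSum d (g (Fin.last d)) ^ ((1 : ℝ) / 2 ^ d) := by
  obtain ⟨n, rfl⟩ := Nat.exists_eq_add_of_le' hd
  obtain ⟨C, e, hC, he, key⟩ := exists_formSum_pow_le_boxSum (n + 1)
  refine ⟨C ^ ((1 : ℝ) / 2 ^ (n + 2)), by positivity, fun N hN g a hb hs ha0 ha => ?_⟩
  set b : Fin (n + 3) → ℤ × ℤ := Fin.cons (1, 0) (Fin.cons (0, 1) fun i => a i.succ.succ)
  have hb0 : b 0 = (1, 0) := rfl
  have hb1 : b 1 = (0, 1) := rfl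
  have hbss : ∀ i : Fin (n + 1), b i.succ.succ = a i.succ.succ := fun i => rfl
  have hbpair : ∀ i j, i ≠ j → (b i).1 * (b j).2 ≠ (b i).2 * (b j).1 := by
    have hlt : ∀ i : Fin (n + 1), 2 ≤ (i.succ.succ : Fin (n + 3)).val := fun i => by simp
    intro i j hij
    refine Fin.cases (fun hij => ?_) (fun i hij => Fin.cases (fun hij => ?_) (fun i hij => ?_) i hij)
      i hij <;>
    refine Fin.cases (fun hij => ?_) (fun j hij => Fin.cases (fun hij => ?_) (fun j hij => ?_) j hij)
      j hij
    · exact absurd rfl hij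
    · simp [hb0, hb1]
    · simpa [hb0, hbss] using (ha0 _ (hlt j)).2
    · simp [hb0, hb1]
    · exact absurd rfl hij
    · simpa [hb1, hbss] using (ha0 _ (hlt j)).1.symm
    · simpa [hb0, hbss] using (ha0 _ (hlt i)).2.symm
    · simpa [hb1, hbss] using (ha0 _ (hlt i)).1
    · exact ha _ _ (hlt i) (hlt j) hij
  have hfin : ∀ i, (Function.support (g i)).Finite := fun i =>
    (Set.finite_Icc (-(N : ℤ)) N).subset fun x hx => by
      by_contra h
      exact hx (hs i x h)
  have hsum : (∑ᶠ z₀ : ℤ, ∑ᶠ z₁ : ℤ, g 0 z₀ * g 1 z₁ *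
      ∏ i ∈ Finset.univ.filter (fun i : Fin (n + 2 + 1) => 2 ≤ (i : ℕ)),
        g i ((a i).1 * z₀ + (a i).2 * z₁)) = formSum g b := by
    rw [formSum, finsum_curry _ (finite_support_prod_dotInt hfin hbpair)]
    refine finsum_congr fun z₀ => finsum_congr fun z₁ => ?_
    rw [prod_filter]
    simp only [Fin.prod_univ_succ (n := n + 2), Fin.prod_univ_succ (n := n + 1)]
    simp [hb0, hb1, hbss, dotInt, mul_assoc]
  rw [hsum]
  obtain ⟨cs, hlen, hcs, key⟩ := key b hbpair
  have hG := boxSum_le_gowersSum (by omega) hcs (hfin (Fin.last (n + 2)))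
  have hQ := boxSum_nonneg (by rintro rfl; simp at hlen) hcs (hfin (Fin.last (n + 2)))
  rw [hlen] at hG
  have hN0 : (0 : ℝ) < N := by exact_mod_cast hN
  have hpow : |formSum g b| ^ 2 ^ (n + 2) ≤
      C * (N : ℝ) ^ e * gowersSum (n + 2) (g (Fin.last (n + 2))) := by
    rw [(Nat.even_pow.2 ⟨even_two, by simp⟩ : Even (2 ^ (n + 2))).pow_abs]
    refine (key N g hN hb hs).trans ?_
    gcongr
  have hG0 := hQ.trans hG
  have hroot := Real.rpow_le_rpow (by positivity) hpow
    (by positivity : (0 : ℝ) ≤ 1 / 2 ^ (n + 2))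
  rw [← Real.rpow_natCast |formSum g b|, ← Real.rpow_mul (abs_nonneg _),
    Real.mul_rpow (by positivity) hG0, Real.mul_rpow hC.le (by positivity),
    ← Real.rpow_natCast (N : ℝ), ← Real.rpow_mul hN0.le] at hroot
  have hone : ((2 ^ (n + 2) : ℕ) : ℝ) * (1 / 2 ^ (n + 2)) = 1 := by
    push_cast
    field_simp
  have hexp : (e : ℝ) * (1 / 2 ^ (n + 2)) = 2 - ((n + 2 : ℕ) + 1) / 2 ^ (n + 2) := by
    have he' : (e : ℝ) + (n + 1 + 2) = 2 ^ (n + 2) * 2 := by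
      rw [← pow_succ]
      exact_mod_cast he
    field_simp
    push_cast
    linarith
  rwa [hone, Real.rpow_one, hexp] at hroot
end

section
/- There exists a constant C_k depending only on k ≥ 1 such that for all α₁, ..., α_r ∈ ℝ/ℤ and all Q ≥ 1 there exists an integer q with 1 ≤ q ≤ Q and max_{1≤i≤r} ‖α_i · q^k‖ ≤ C_k · Q^{-exp(-C_k·r)}, where ‖·‖ denotes distance to the nearest integer. Crucially, the constant C_k does not depend on r. -/
section

open Finset Polynomial
open scoped FourierTransform

/-- The unit circle distance is controlled by the chord `‖e(x) - 1‖`. -/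
lemma norm_unitAddCircle_le_norm_fourierChar_sub_one (x : ℝ) :
    ‖(x : UnitAddCircle)‖ ≤ ‖(𝐞 x : ℂ) - 1‖ := by
  have hper : (𝐞 x : ℂ) = 𝐞 (x - round x) := by
    simp only [Real.fourierChar_apply]
    rw [Complex.exp_eq_exp_iff_exists_int]
    exact ⟨round x, by push_cast; ring⟩
  rw [UnitAddCircle.norm_eq, hper, Real.fourierChar_apply, mul_comm _ Complex.I,
    Complex.norm_exp_I_mul_ofReal_sub_one]
  set y := x - round x with hy
  have hy2 : |y| ≤ 1 / 2 := abs_sub_round x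
  have hpi := Real.pi_pos
  have h := Real.mul_abs_le_abs_sin (x := Real.pi * y) (by
    rw [abs_mul, abs_of_pos hpi]; nlinarith)
  rw [show 2 * Real.pi * y / 2 = Real.pi * y by ring, Real.norm_eq_abs, abs_mul, abs_two]
  rw [abs_mul, abs_of_pos hpi] at h
  have : 2 / Real.pi * (Real.pi * |y|) = 2 * |y| := by field_simp
  nlinarith [abs_nonneg y]

/-- Geometric sums of additive characters. -/
lemma norm_unitAddCircle_mul_norm_sum_le (x : ℝ) (N : ℕ) :
    ‖(x : UnitAddCircle)‖ * ‖∑ n ∈ range N, (𝐞 (n * x) : ℂ)‖ ≤ 2 := by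
  have hpow : ∀ n : ℕ, (𝐞 (n * x) : ℂ) = (𝐞 x : ℂ) ^ n := fun n ↦ by
    rw [← nsmul_eq_mul, AddChar.map_nsmul_eq_pow]; simp
  simp only [hpow]
  calc _ ≤ ‖(𝐞 x : ℂ) - 1‖ * ‖∑ n ∈ range N, (𝐞 x : ℂ) ^ n‖ := by
        gcongr; exact norm_unitAddCircle_le_norm_fourierChar_sub_one x
    _ = ‖(𝐞 x : ℂ) ^ N - 1‖ := by rw [← norm_mul, mul_geom_sum]
    _ ≤ ‖(𝐞 x : ℂ) ^ N‖ + ‖(1 : ℂ)‖ := norm_sub_le _ _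
    _ = 2 := by rw [norm_pow, Circle.norm_coe]; norm_num

/-- If the phases `F t` have pairwise small correlations, then the mean square of
`∑ t, e(F t n)` is close to its diagonal contribution. -/
lemma abs_sum_norm_sq_sub_le (F : ℕ → ℕ → ℝ) (T N : ℕ) {B : ℝ} (hB : 0 ≤ B)
    (h : ∀ t < T, ∀ s < T, t ≠ s → ‖∑ n ∈ range N, (𝐞 (F t n - F s n) : ℂ)‖ ≤ B) :
    |∑ n ∈ range N, ‖∑ t ∈ range T, (𝐞 (F t n) : ℂ)‖ ^ 2 - T * N| ≤ T ^ 2 * B := by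
  have key : (((∑ n ∈ range N, ‖∑ t ∈ range T, (𝐞 (F t n) : ℂ)‖ ^ 2 - T * N : ℝ)) : ℂ) =
      ∑ t ∈ range T, ∑ s ∈ range T,
        if t = s then 0 else ∑ n ∈ range N, (𝐞 (F t n - F s n) : ℂ) := by
    have hsq : ∀ n, ((‖∑ t ∈ range T, (𝐞 (F t n) : ℂ)‖ : ℂ)) ^ 2 =
        ∑ t ∈ range T, ∑ s ∈ range T, (𝐞 (F t n - F s n) : ℂ) := fun n ↦ by
      rw [← Complex.mul_conj', map_sum, sum_mul_sum]
      refine sum_congr rfl fun t _ ↦ sum_congr rfl fun s _ ↦ ?_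
      rw [sub_eq_add_neg, AddChar.map_add_eq_mul, AddChar.map_neg_eq_inv, Circle.coe_mul,
        Circle.coe_inv_eq_conj]
    push_cast
    simp only [hsq]
    rw [sum_comm, sub_eq_iff_eq_add]
    have hdiag : ((T : ℂ) * N) =
        ∑ t ∈ range T, ∑ s ∈ range T, if t = s then (N : ℂ) else 0 := by
      simp +contextual [sum_ite_eq]
    rw [hdiag, ← sum_add_distrib]
    refine sum_congr rfl fun t _ ↦ ?_
    rw [sum_comm, ← sum_add_distrib]
    refine sum_congr rfl fun s _ ↦ ?_
    split_ifs with hts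
    · subst hts; simp
    · simp
  rw [← Real.norm_eq_abs, ← Complex.norm_real, key]
  calc _ ≤ ∑ t ∈ range T, ∑ s ∈ range T, B := by
        refine norm_sum_le_of_le _ fun t ht ↦ norm_sum_le_of_le _ fun s hs ↦ ?_
        split_ifs with hts
        · simpa using hB
        · exact h t (mem_range.1 ht) s (mem_range.1 hs) hts
    _ = T ^ 2 * B := by simp; ring

/-- Shifting the range of summation by `t` changes a sum of terms of norm at most one by at
most `2t`. -/
lemma norm_sum_shift_sub_le {g : ℕ → ℂ} (hg : ∀ n, ‖g n‖ ≤ 1) (N t : ℕ) :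
    ‖∑ n ∈ range N, g (n + t) - ∑ n ∈ range N, g n‖ ≤ 2 * t := by
  have hb : ∀ m, ‖∑ n ∈ range t, g (m + n)‖ ≤ t := fun m ↦
    (norm_sum_le_of_le _ fun n _ ↦ hg (m + n)).trans (by simp)
  have h3 : ∑ n ∈ range N, g (n + t) - ∑ n ∈ range N, g n =
      ∑ n ∈ range t, g (N + n) - ∑ n ∈ range t, g (0 + n) := by
    have h1 := sum_range_add g t N
    have h2 := sum_range_add g N t
    rw [add_comm N t, h1] at h2
    simp only [zero_add, add_comm _ t] at h2 ⊢
    linear_combination h2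
  rw [h3]
  calc _ ≤ (t : ℝ) + t := (norm_sub_le _ _).trans (add_le_add (hb _) (hb _))
    _ = 2 * t := by ring

/-- Van der Corput: a large exponential sum correlates with one of its short translates. -/
lemma exists_large_correlation {A : ℝ} (hA : 2 ≤ A) {T N : ℕ} (hT : 8 * A ^ 2 ≤ T)
    (hN : 4 * T * A < N) (f : ℕ → ℝ) (hf : N ≤ A * ‖∑ n ∈ range N, (𝐞 (f n) : ℂ)‖) :
    ∃ t < T, ∃ s < T, t ≠ s ∧
      N ≤ 16 * A ^ 2 * ‖∑ n ∈ range N, (𝐞 (f (n + t) - f (n + s)) : ℂ)‖ := by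
  by_contra! hcon
  have hA0 : 0 < A := by linarith
  have hT0 : (0 : ℝ) < T := by nlinarith
  have hN0 : (0 : ℝ) < N := by nlinarith [mul_pos hT0 hA0]
  set S := ∑ n ∈ range N, (𝐞 (f n) : ℂ) with hS
  have hms := abs_sum_norm_sq_sub_le (fun t n ↦ f (n + t)) T N (B := N / (16 * A ^ 2))
    (by positivity) (fun t ht s hs hts ↦ by
      rw [le_div_iff₀ (by positivity), mul_comm]; exact (hcon t ht s hs hts).le)
  set G := ∑ n ∈ range N, ‖∑ t ∈ range T, (𝐞 (f (n + t)) : ℂ)‖ ^ 2 with hG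
  have hcs : ‖∑ n ∈ range N, ∑ t ∈ range T, (𝐞 (f (n + t)) : ℂ)‖ ^ 2 ≤ N * G := by
    calc _ ≤ (∑ n ∈ range N, ‖∑ t ∈ range T, (𝐞 (f (n + t)) : ℂ)‖) ^ 2 := by
          gcongr; exact norm_sum_le _ _
      _ ≤ _ := by
          simpa using sq_sum_le_card_mul_sum_sq (s := range N)
            (f := fun n ↦ ‖∑ t ∈ range T, (𝐞 (f (n + t)) : ℂ)‖)
  rw [sum_comm] at hcs
  have hsh : ‖∑ t ∈ range T, ∑ n ∈ range N, (𝐞 (f (n + t)) : ℂ) - T * S‖ ≤ 2 * T ^ 2 := by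
    have : (T : ℂ) * S = ∑ t ∈ range T, S := by simp
    rw [this, ← sum_sub_distrib]
    calc _ ≤ ∑ t ∈ range T, (2 * T : ℝ) := norm_sum_le_of_le _ fun t ht ↦
          (norm_sum_shift_sub_le (g := fun n ↦ (𝐞 (f n) : ℂ))
            (fun n ↦ (Circle.norm_coe _).le) N t).trans (by
            have := mem_range.1 ht
            gcongr)
      _ = _ := by simp; ring
  set U := ∑ t ∈ range T, ∑ n ∈ range N, (𝐞 (f (n + t)) : ℂ) with hU
  have hU1 : T * ‖S‖ - 2 * T ^ 2 ≤ ‖U‖ := by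
    have h1 := norm_sub_norm_le ((T : ℂ) * S) U
    rw [norm_sub_rev, norm_mul, Complex.norm_natCast] at h1
    linarith
  have hU2 : T * N ≤ 2 * A * ‖U‖ := by nlinarith
  have hU3 : (T * N : ℝ) ^ 2 ≤ 4 * A ^ 2 * (N * G) := by
    calc (T * N : ℝ) ^ 2 ≤ (2 * A * ‖U‖) ^ 2 := by gcongr
      _ = 4 * A ^ 2 * ‖U‖ ^ 2 := by ring
      _ ≤ _ := by gcongr
  have hG1 : G ≤ T * N + T ^ 2 * (N / (16 * A ^ 2)) := by
    linarith [(abs_le.1 hms).2]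
  have h4 : 4 * A ^ 2 * (N * G) ≤ 4 * A ^ 2 * T * N ^ 2 + T ^ 2 * N ^ 2 / 4 := by
    calc _ ≤ 4 * A ^ 2 * (N * (T * N + T ^ 2 * (N / (16 * A ^ 2)))) := by gcongr
      _ = _ := by field_simp; ring
  have h5 : 4 * A ^ 2 * T * N ^ 2 ≤ T / 2 * T * N ^ 2 := by gcongr; linarith
  have h6 : (0 : ℝ) < T ^ 2 * N ^ 2 := by positivity
  nlinarith

lemma coeff_taylor_sub_taylor {p : ℝ[X]} {k : ℕ} (hp : p.natDegree ≤ k + 1) (a b : ℝ) :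
    (taylor a p - taylor b p).natDegree ≤ k ∧
      (taylor a p - taylor b p).coeff k = (k + 1) * (a - b) * p.coeff (k + 1) := by
  have hlin : ∀ c : ℝ, (taylor c p).coeff k = p.coeff k + (k + 1) * p.coeff (k + 1) * c := by
    intro c
    have hd : (hasseDeriv k p).natDegree ≤ 1 := (natDegree_hasseDeriv_le p k).trans (by omega)
    rw [taylor_coeff, eval_eq_sum_range' (n := 2) (by omega)]
    simp [sum_range_succ, hasseDeriv_coeff, add_comm 1 k]
  have htop : ∀ c : ℝ, (taylor c p).coeff (k + 1) = p.coeff (k + 1) := by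
    intro c
    have hd : (hasseDeriv (k + 1) p).natDegree ≤ 0 :=
      (natDegree_hasseDeriv_le p _).trans (by omega)
    rw [taylor_coeff, eval_eq_sum_range' (n := 1) (by omega)]
    simp [hasseDeriv_coeff]
  refine ⟨natDegree_le_iff_coeff_eq_zero.2 fun n hn ↦ ?_, ?_⟩
  · rcases eq_or_lt_of_le (Nat.succ_le_of_lt hn) with rfl | hn
    · simp [htop]
    · rw [coeff_eq_zero_of_natDegree_lt]
      refine (natDegree_sub_le _ _).trans_lt ?_
      simp only [natDegree_taylor]
      omega
  · rw [coeff_sub, hlin, hlin]; ring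

lemma exists_nat_between_sq_pow_six {A : ℝ} (hA : 2 ≤ A) :
    ∃ T : ℕ, 8 * A ^ 2 ≤ T ∧ (T : ℝ) ≤ A ^ 6 := by
  refine ⟨⌈8 * A ^ 2⌉₊, Nat.le_ceil _, (Nat.ceil_lt_add_one (by positivity)).le.trans ?_⟩
  have h4 : (2 : ℝ) ^ 4 ≤ A ^ 4 := by gcongr
  have : A ^ 6 = A ^ 4 * A ^ 2 := by ring
  nlinarith

/-- Weyl's inequality in inverse form: a large polynomial exponential sum forces the leading
coefficient to be close to a rational with small denominator. -/
lemma exists_small_multiple_of_large_sum (k : ℕ) : ∃ c : ℕ, ∀ A : ℝ, 2 ≤ A → ∀ (N : ℕ) (p : ℝ[X]),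
    p.natDegree ≤ k + 1 → N ≤ A * ‖∑ n ∈ range N, (𝐞 (p.eval (n : ℝ)) : ℂ)‖ →
    ∃ q : ℕ, 1 ≤ q ∧ (q : ℝ) ≤ A ^ c ∧
      ‖((q * p.coeff (k + 1) : ℝ) : UnitAddCircle)‖ * N ≤ A ^ c := by
  induction k with
  | zero =>
    refine ⟨2, fun A hA N p hp hN ↦ ⟨1, le_rfl, by push_cast; nlinarith, ?_⟩⟩
    have hsum : ‖∑ n ∈ range N, (𝐞 (p.eval (n : ℝ)) : ℂ)‖ =
        ‖∑ n ∈ range N, (𝐞 (n * p.coeff 1) : ℂ)‖ := by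
      have : ∀ n : ℕ, (𝐞 (p.eval (n : ℝ)) : ℂ) = 𝐞 (p.coeff 0) * 𝐞 (n * p.coeff 1) := fun n ↦ by
        rw [eval_eq_sum_range' (n := 2) (by omega), ← Circle.coe_mul, ← AddChar.map_add_eq_mul]
        simp [sum_range_succ, mul_comm]
      simp only [this, ← mul_sum, norm_mul, Circle.norm_coe, one_mul]
    have hgeo := norm_unitAddCircle_mul_norm_sum_le (p.coeff 1) N
    rw [hsum] at hN
    simp only [Nat.cast_one, one_mul, zero_add]
    calc _ ≤ ‖(p.coeff 1 : UnitAddCircle)‖ * (A * ‖∑ n ∈ range N, (𝐞 (n * p.coeff 1) : ℂ)‖) := by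
          gcongr
      _ ≤ A * 2 := by nlinarith
      _ ≤ A ^ 2 := by nlinarith
  | succ k ih =>
    obtain ⟨c, hc⟩ := ih
    refine ⟨6 * c + k + 12, fun A hA N p hp hN ↦ ?_⟩
    have hA1 : 1 ≤ A := by linarith
    obtain ⟨T, hT, hT'⟩ := exists_nat_between_sq_pow_six hA
    by_cases hbig : 4 * T * A < N
    · obtain ⟨t, ht, s, hs, hts, hcor⟩ :=
        exists_large_correlation hA hT hbig (fun n ↦ p.eval (n : ℝ)) hN
      obtain ⟨hdeg, hcoeff⟩ := coeff_taylor_sub_taylor hp (t : ℝ) (s : ℝ)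
      have hA' : 16 * A ^ 2 ≤ A ^ 6 := by
        calc 16 * A ^ 2 = 2 ^ 4 * A ^ 2 := by norm_num
          _ ≤ A ^ 4 * A ^ 2 := by gcongr
          _ = A ^ 6 := by ring
      obtain ⟨q, hq1, hqA, hqN⟩ := hc (A ^ 6) (by nlinarith) N
        (taylor (t : ℝ) p - taylor (s : ℝ) p) hdeg (by
          simp only [eval_sub, taylor_eval]
          push_cast at hcor
          exact hcor.trans (by gcongr))
      have hd : 1 ≤ ((t : ℤ) - s).natAbs := by omega
      have hd' : (((t : ℤ) - s).natAbs : ℝ) ≤ A ^ 6 := by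
        refine le_trans ?_ hT'
        exact_mod_cast (by omega : ((t : ℤ) - s).natAbs ≤ T)
      have hk : ((k + 2 : ℕ) : ℝ) ≤ A ^ (k + 2) := by
        calc ((k + 2 : ℕ) : ℝ) ≤ 2 ^ (k + 2) := by exact_mod_cast (Nat.lt_two_pow_self).le
          _ ≤ _ := by gcongr
      refine ⟨q * ((k + 2) * ((t : ℤ) - s).natAbs), ?_, ?_, ?_⟩
      · exact Nat.mul_pos hq1 (Nat.mul_pos (by omega) hd)
      · push_cast at hk ⊢
        calc _ ≤ (A ^ 6) ^ c * (A ^ (k + 2) * A ^ 6) := by gcongr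
          _ = A ^ (6 * c + k + 8) := by ring
          _ ≤ _ := pow_le_pow_right₀ hA1 (by omega)
      · have habs : ((((t : ℤ) - s).natAbs : ℕ) : ℝ) = |(t : ℝ) - s| := by
          rw [Nat.cast_natAbs]; push_cast; rfl
        have hnorm : ‖(((q * ((k + 2) * ((t : ℤ) - s).natAbs) : ℕ) * p.coeff (k + 1 + 1) : ℝ) :
            UnitAddCircle)‖ = ‖((q * (taylor (t : ℝ) p - taylor (s : ℝ) p).coeff (k + 1) : ℝ) :
            UnitAddCircle)‖ := by
          rw [hcoeff]
          push_cast [habs]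
          rcases abs_choice ((t : ℝ) - s) with h | h <;> rw [h]
          · congr 2; ring
          · rw [← norm_neg, ← AddCircle.coe_neg]; congr 2; ring
        rw [hnorm]
        refine hqN.trans ?_
        rw [← pow_mul]
        exact pow_le_pow_right₀ hA1 (by omega)
    · refine ⟨1, le_rfl, by simpa using one_le_pow₀ hA1, ?_⟩
      have h1 := AddCircle.norm_le_half_period 1
        (x := (((1 : ℕ) * p.coeff (k + 1 + 1) : ℝ) : UnitAddCircle)) one_ne_zero
      rw [abs_one] at h1
      push Not at hbig
      calc _ ≤ 1 / 2 * (4 * A ^ 6 * A) := by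
            gcongr
            exact hbig.trans (by gcongr)
        _ ≤ A * A ^ 6 * A := by nlinarith [pow_pos (show 0 < A by linarith) 7]
        _ = A ^ 8 := by ring
        _ ≤ _ := pow_le_pow_right₀ hA1 (by omega)

lemma norm_natCast_mul_le (m : ℕ) (x : ℝ) :
    ‖((m * x : ℝ) : UnitAddCircle)‖ ≤ m * ‖(x : UnitAddCircle)‖ := by
  rw [← nsmul_eq_mul, AddCircle.coe_nsmul]
  exact norm_nsmul_le

/-- Heilbronn's theorem with a power saving: some `k`-th power multiple of `α` is close to an
integer. -/
lemma exists_norm_mul_pow_le (k : ℕ) : ∃ D : ℕ, ∀ A : ℝ, 2 ≤ A → ∀ α : ℝ,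
    ∃ q : ℕ, 1 ≤ q ∧ (q : ℝ) ≤ A ^ D ∧ ‖((α * q ^ (k + 1) : ℝ) : UnitAddCircle)‖ ≤ 1 / A := by
  obtain ⟨c, hc⟩ := exists_small_multiple_of_large_sum k
  set E := 8 * c + 8 with hE
  refine ⟨E * (k + 1) + 1, fun A hA α ↦ ?_⟩
  have hA0 : 0 < A := by linarith
  have hA1 : 1 ≤ A := by linarith
  obtain ⟨M, hM, hM'⟩ := exists_nat_between_sq_pow_six hA
  have hM0 : (0 : ℝ) < M := by nlinarith
  by_contra! hcon
  set R := A ^ (E * (k + 1) + 1) with hR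
  set N := ⌊R⌋₊ with hN
  have hR1 : 1 ≤ R := one_le_pow₀ hA1
  have hN1 : (1 : ℝ) ≤ N := by exact_mod_cast (Nat.one_le_floor_iff R).2 hR1
  have hNR : (N : ℝ) ≤ R := Nat.floor_le (by linarith)
  have hRN : R ≤ 2 * N := by linarith [Nat.lt_floor_add_one R]
  obtain ⟨t, ht, s, hs, hts, hcor⟩ : ∃ t < M, ∃ s < M, t ≠ s ∧
      N < 4 * M * ‖∑ n ∈ range N,
        (𝐞 (t * (α * (n + 1) ^ (k + 1)) - s * (α * (n + 1) ^ (k + 1))) : ℂ)‖ := by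
    by_contra! hsmall
    have hms := abs_sum_norm_sq_sub_le (fun t n ↦ t * (α * (n + 1) ^ (k + 1))) M N
      (B := N / (4 * M)) (by positivity) (fun t ht s hs hts ↦ by
        rw [le_div_iff₀ (by positivity), mul_comm]; exact hsmall t ht s hs hts)
    have hup : ∑ n ∈ range N, ‖∑ t ∈ range M, (𝐞 (t * (α * (n + 1) ^ (k + 1))) : ℂ)‖ ^ 2 ≤
        N * (2 * A) ^ 2 := by
      calc _ ≤ ∑ n ∈ range N, (2 * A) ^ 2 := by
            refine sum_le_sum fun n hn ↦ ?_
            gcongr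
            have h1 := norm_unitAddCircle_mul_norm_sum_le (α * (n + 1) ^ (k + 1)) M
            have hnN : ((n + 1 : ℕ) : ℝ) ≤ N := by exact_mod_cast mem_range.1 hn
            have h2 := hcon (n + 1) (by omega) (hnN.trans hNR)
            push_cast at h2
            set W := ‖∑ t ∈ range M, (𝐞 (t * (α * (n + 1) ^ (k + 1))) : ℂ)‖
            have h3 : 1 / A * W ≤ 2 := le_trans (by gcongr) h1
            rw [one_div_mul_eq_div, div_le_iff₀ hA0] at h3
            exact h3
        _ = _ := by simp
    have hlow := (abs_le.1 hms).1
    have hB : (M : ℝ) ^ 2 * (N / (4 * M)) = M * N / 4 := by field_simp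
    have : 8 * A ^ 2 * N ≤ M * N := by gcongr
    nlinarith [mul_pos hM0 (show (0 : ℝ) < N by linarith)]
  obtain ⟨q, hq1, hqA, hqN⟩ := hc (A ^ 8) (by nlinarith [one_le_pow₀ hA1 (n := 7)]) N
    (C ((t - s) * α) * (X + C 1) ^ (k + 1))
    ((natDegree_C_mul_le _ _).trans (by rw [natDegree_pow, natDegree_X_add_C, mul_one])) (by
      simp only [eval_mul, eval_C, eval_pow, eval_add, eval_X]
      simp only [← sub_mul, ← mul_assoc] at hcor ⊢
      refine hcor.le.trans ?_
      gcongr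
      calc (4 * M : ℝ) ≤ 2 ^ 2 * A ^ 6 := by norm_num; exact hM'
        _ ≤ A ^ 2 * A ^ 6 := by gcongr
        _ = A ^ 8 := by ring)
  have hcoeff : (C ((t - s) * α) * (X + C (1 : ℝ)) ^ (k + 1)).coeff (k + 1) = (t - s) * α := by
    rw [coeff_C_mul, coeff_X_add_C_pow]; simp
  rw [hcoeff, ← pow_mul] at hqN
  rw [← pow_mul] at hqA
  set d := ((t : ℤ) - s).natAbs with hd
  have hd1 : 1 ≤ d := by omega
  have hdA : (d : ℝ) ≤ A ^ 6 := le_trans (by exact_mod_cast (by omega : d ≤ M)) hM'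
  have hdabs : (d : ℝ) = |(t : ℝ) - s| := by rw [hd, Nat.cast_natAbs]; push_cast; rfl
  have hqd : ((q * d : ℕ) : ℝ) ≤ A ^ E := by
    push_cast
    calc (q * d : ℝ) ≤ A ^ (8 * c) * A ^ 6 := by gcongr
      _ = A ^ (8 * c + 6) := by ring
      _ ≤ _ := pow_le_pow_right₀ hA1 (by omega)
  have hnorm : ‖(((q * d : ℕ) * α : ℝ) : UnitAddCircle)‖ =
      ‖((q * ((t - s) * α) : ℝ) : UnitAddCircle)‖ := by
    push_cast [hdabs]
    rcases abs_choice ((t : ℝ) - s) with h | h <;> rw [h]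
    · congr 2; ring
    · rw [← norm_neg, ← AddCircle.coe_neg]; congr 2; ring
  rw [← hnorm] at hqN
  have hlt := hcon (q * d) (Nat.mul_pos hq1 hd1)
    (hqd.trans (pow_le_pow_right₀ hA1 (by nlinarith)))
  have hle : ‖((α * (q * d : ℕ) ^ (k + 1) : ℝ) : UnitAddCircle)‖ ≤
      A ^ (E * k) * ‖(((q * d : ℕ) * α : ℝ) : UnitAddCircle)‖ := by
    have := norm_natCast_mul_le ((q * d) ^ k) ((q * d : ℕ) * α)
    calc _ = ‖((((q * d) ^ k : ℕ) * ((q * d : ℕ) * α) : ℝ) : UnitAddCircle)‖ := by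
          congr 2; push_cast; ring
      _ ≤ _ := this
      _ ≤ _ := by
          gcongr
          rw [pow_mul, Nat.cast_pow]
          gcongr
  have h1 : 1 / A * N < A ^ (E * k) * A ^ (8 * c) := by
    calc 1 / A * N < A ^ (E * k) * ‖(((q * d : ℕ) * α : ℝ) : UnitAddCircle)‖ * N := by
          gcongr; exact hlt.trans_le hle
      _ ≤ _ := by rw [mul_assoc]; gcongr
  rw [one_div_mul_eq_div, div_lt_iff₀ hA0] at h1
  have h2 : 2 * (A ^ (E * k) * A ^ (8 * c) * A) ≤ R := by
    calc _ ≤ A * (A ^ (E * k) * A ^ (8 * c) * A) := by gcongr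
      _ = A ^ (E * k + 8 * c + 2) := by ring
      _ ≤ _ := pow_le_pow_right₀ hA1 (by rw [mul_add]; omega)
  linarith

/-- Simultaneous approximation by iterating the single-frequency estimate. -/
lemma exists_forall_norm_mul_pow_le (k : ℕ) : ∃ E : ℕ, 1 ≤ E ∧ ∀ (r : ℕ) (α : Fin r → ℝ) (A : ℝ),
    2 ≤ A → ∃ q : ℕ, 1 ≤ q ∧ (q : ℝ) ≤ A ^ (E ^ r) ∧
      ∀ i, ‖((α i * q ^ (k + 1) : ℝ) : UnitAddCircle)‖ ≤ 1 / A := by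
  obtain ⟨D, hD⟩ := exists_norm_mul_pow_le k
  refine ⟨D * (k + 1) + 1 + D, by omega, fun r ↦ ?_⟩
  set E := D * (k + 1) + 1 + D with hE
  induction r with
  | zero => exact fun α A hA ↦ ⟨1, le_rfl, by simp; linarith, fun i ↦ i.elim0⟩
  | succ r ih =>
    intro α A hA
    have hA0 : 0 < A := by linarith
    have hA1 : 1 ≤ A := by linarith
    obtain ⟨q₁, hq₁, hq₁A, hα₁⟩ := ih (fun i ↦ α i.castSucc) (A ^ (D * (k + 1) + 1))
      (hA.trans (le_self_pow₀ hA1 (by omega)))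
    obtain ⟨q₂, hq₂, hq₂A, hα₂⟩ := hD A hA (α (Fin.last r) * q₁ ^ (k + 1))
    refine ⟨q₁ * q₂, Nat.mul_pos hq₁ hq₂, ?_, fun i ↦ ?_⟩
    · push_cast
      calc (q₁ * q₂ : ℝ) ≤ (A ^ (D * (k + 1) + 1)) ^ (E ^ r) * A ^ D := by gcongr
        _ = A ^ ((D * (k + 1) + 1) * E ^ r + D) := by ring
        _ ≤ A ^ (E ^ (r + 1)) := pow_le_pow_right₀ hA1 (by
            have : 1 ≤ E ^ r := Nat.one_le_pow _ _ (by omega)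
            rw [pow_succ]
            nlinarith)
    · induction i using Fin.lastCases with
      | last => convert hα₂ using 3; push_cast; ring
      | cast i =>
        calc ‖((α i.castSucc * (q₁ * q₂ : ℕ) ^ (k + 1) : ℝ) : UnitAddCircle)‖
            = ‖(((q₂ ^ (k + 1) : ℕ) * (α i.castSucc * q₁ ^ (k + 1)) : ℝ) : UnitAddCircle)‖ := by
              congr 2; push_cast; ring
          _ ≤ (q₂ ^ (k + 1) : ℕ) * ‖((α i.castSucc * q₁ ^ (k + 1) : ℝ) : UnitAddCircle)‖ :=
              norm_natCast_mul_le _ _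
          _ ≤ (A ^ D) ^ (k + 1) * (1 / A ^ (D * (k + 1) + 1)) := by
              rw [Nat.cast_pow]
              gcongr
              exact hα₁ i
          _ = 1 / A := by rw [← pow_mul, pow_succ]; field_simp

end

/-- Simultaneous Diophantine approximation by perfect `k`-th powers (Cook's
theorem with implied constant independent of `r`): there is `C = C(k)` such that
for all `α₁, …, α_r` and `Q ≥ 1` there is `1 ≤ q ≤ Q` with
`max_i ‖α_i q^k‖ ≤ C · Q^{-exp(-C r)}`. -/
theorem simultaneous_kth_power_recurrence (k : ℕ) (hk : 1 ≤ k) :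
    ∃ C : ℝ, 0 < C ∧
      ∀ (r : ℕ) (α : Fin r → ℝ) (Q : ℝ), 1 ≤ Q →
        ∃ q : ℕ, 1 ≤ q ∧ (q : ℝ) ≤ Q ∧
          ∀ i : Fin r,
            |α i * (q : ℝ) ^ k - (round (α i * (q : ℝ) ^ k) : ℝ)| ≤
              C * Q ^ (-(Real.exp (-(C * r)))) := by
  obtain ⟨k, rfl⟩ := Nat.exists_eq_add_of_le' hk
  obtain ⟨E, hE1, hE⟩ := exists_forall_norm_mul_pow_le k
  have hE0 : (1 : ℝ) ≤ E := by exact_mod_cast hE1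
  refine ⟨E, by linarith, fun r α Q hQ ↦ ?_⟩
  simp only [← UnitAddCircle.norm_eq]
  have hQ0 : 0 < Q := by linarith
  have hEr : (0 : ℝ) < (E : ℝ) ^ r := by positivity
  set A := Q ^ ((E : ℝ) ^ r)⁻¹ with hA
  have hA0 : 0 < A := Real.rpow_pos_of_pos hQ0 _
  have hAQ : A ^ (E ^ r) = Q := by
    rw [← Real.rpow_natCast, hA, ← Real.rpow_mul hQ0.le]
    push_cast
    rw [inv_mul_cancel₀ hEr.ne', Real.rpow_one]
  have hexp : Real.exp (-(E * r)) ≤ ((E : ℝ) ^ r)⁻¹ := by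
    rw [Real.exp_neg, mul_comm, Real.exp_nat_mul]
    gcongr
    linarith [Real.add_one_le_exp (E : ℝ)]
  have hbound : 1 / A ≤ E * Q ^ (-Real.exp (-(E * r))) := by
    calc 1 / A = 1 * Q ^ (-((E : ℝ) ^ r)⁻¹) := by rw [hA, Real.rpow_neg hQ0.le]; simp
      _ ≤ _ := by gcongr
  rcases le_or_gt 2 A with h2 | h2
  · obtain ⟨q, hq1, hqA, hq⟩ := hE r α A h2
    exact ⟨q, hq1, hqA.trans hAQ.le, fun i ↦ (hq i).trans hbound⟩
  · refine ⟨1, le_rfl, by simpa using hQ, fun i ↦ ?_⟩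
    refine (AddCircle.norm_le_half_period 1 one_ne_zero).trans (le_trans ?_ hbound)
    rw [abs_one]
    gcongr
end
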